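/- The map B : f ↦ f ∘ C⁻, where C⁻(x) = e^{i arccos(x)}, is a bijection from the set of continuous functions f : ∂𝔻 → ℂ that are positive definite (resp. strictly positive definite) on Ω₂ and invariant under conjugation (f(e^{iφ}) = f(e^{−iφ}) for all φ), onto the set of continuous functions on [−1,1] that are positive definite (resp. strictly positive definite) on S¹; its inverse is ĝ ↦ ĝ ∘ C with C(e^{iφ}) = cos(φ). -/

import Mathlib

open scoped ComplexOrder

noncomputable section

/-- A kernel `K` on a type `α` is positive definite. -/
def IsPDKernelT {α : Type*} (K : α → α → ℂ) : Prop :=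
  ∀ (L : ℕ) (x : Fin L → α), Function.Injective x →
    ∀ c : Fin L → ℂ, 0 ≤ ∑ μ, ∑ ν, c μ * (starRingEnd ℂ) (c ν) * K (x μ) (x ν)

/-- A kernel `K` on a type `α` is strictly positive definite. -/
def IsSPDKernelT {α : Type*} (K : α → α → ℂ) : Prop :=
  IsPDKernelT K ∧
    ∀ (L : ℕ) (x : Fin L → α), Function.Injective x →
      ∀ c : Fin L → ℂ,
        ∑ μ, ∑ ν, c μ * (starRingEnd ℂ) (c ν) * K (x μ) (x ν) = 0 → c = 0

/-- The unit circle `∂𝔻 = Ω₂`, as a subtype of ℂ. -/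
abbrev CircleC : Type := ↥(Metric.sphere (0 : ℂ) 1)

/-- The unit circle `S¹ ⊆ ℝ²`. -/
abbrev SphereR2 : Type := ↥(Metric.sphere (0 : EuclideanSpace ℝ (Fin 2)) 1)

/-- The interval `[-1, 1]` as a subtype of ℝ. -/
abbrev IccT : Type := ↥(Set.Icc (-1 : ℝ) 1)

/-- The product `z·z' = z conj(z')` on `Ω₂`. -/
def cMul (z w : CircleC) : CircleC :=
  ⟨z.1 * (starRingEnd ℂ) w.1, by
    have hz := mem_sphere_zero_iff_norm.mp z.2
    have hw := mem_sphere_zero_iff_norm.mp w.2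
    rw [mem_sphere_zero_iff_norm, norm_mul]
    simp [hz, hw]⟩

/-- The point `e^{iφ}` of the circle. -/
def circExp (φ : ℝ) : CircleC :=
  ⟨Complex.exp ((φ : ℂ) * Complex.I), by
    rw [mem_sphere_zero_iff_norm, Complex.norm_exp_ofReal_mul_I]⟩

/-- The map `C⁻ : [-1,1] → ∂𝔻`, `x ↦ e^{i arccos x}`. -/
def Cminus (x : IccT) : CircleC := circExp (Real.arccos x.1)

/-- The map `C : ∂𝔻 → [-1,1]`, `e^{iφ} ↦ cos φ`, i.e. `ξ ↦ Re ξ`. -/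
def Cmap (z : CircleC) : IccT :=
  ⟨z.1.re, by
    have hz := mem_sphere_zero_iff_norm.mp z.2
    have := Complex.abs_re_le_norm z.1
    rw [hz] at this
    exact abs_le.mp this⟩

/-- The Euclidean inner product of two points of `S¹`, landing in `[-1,1]`. -/
def rdot (u v : SphereR2) : IccT :=
  ⟨@inner ℝ _ _ u.1 v.1, by
    have hu := mem_sphere_zero_iff_norm.mp u.2
    have hv := mem_sphere_zero_iff_norm.mp v.2
    have := abs_real_inner_le_norm u.1 v.1
    rw [hu, hv] at this
    simpa using abs_le.mp this⟩

/-- The continuous functions on `∂𝔻` which are PD (`strict = false`) or SPD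
(`strict = true`) on `Ω₂` and invariant under conjugation. -/
def classCircle (strict : Bool) : Set (CircleC → ℂ) :=
  {f | Continuous f ∧
    (if strict then IsSPDKernelT (fun z w => f (cMul z w))
      else IsPDKernelT (fun z w => f (cMul z w))) ∧
    ∀ φ : ℝ, f (circExp φ) = f (circExp (-φ))}

/-- The continuous functions on `[-1,1]` which are PD (`strict = false`) or SPD
(`strict = true`) on `S¹`. -/
def classS1 (strict : Bool) : Set (IccT → ℂ) :=
  {g | Continuous g ∧
    (if strict then IsSPDKernelT (fun u v => g (rdot u v))
      else IsPDKernelT (fun u v => g (rdot u v)))}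

/-- Positive definiteness is inherited by the pullback of a kernel along an injective map. -/
theorem IsPDKernelT.comp_injective {α β : Type*} {K : β → β → ℂ} (hK : IsPDKernelT K)
    {e : α → β} (he : Function.Injective e) : IsPDKernelT (fun x y => K (e x) (e y)) :=
  fun L x hx c => hK L (e ∘ x) (he.comp hx) c

/-- Strict positive definiteness is inherited by the pullback of a kernel along an injective
map. -/
theorem IsSPDKernelT.comp_injective {α β : Type*} {K : β → β → ℂ} (hK : IsSPDKernelT K)
    {e : α → β} (he : Function.Injective e) : IsSPDKernelT (fun x y => K (e x) (e y)) :=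
  ⟨hK.1.comp_injective he, fun L x hx c h => hK.2 L (e ∘ x) (he.comp hx) c h⟩

/-- The identification of the unit circle of `ℂ` with the unit circle of `ℝ²`. -/
def circleToSphere (z : CircleC) : SphereR2 :=
  ⟨Complex.orthonormalBasisOneI.repr z.1, by
    rw [mem_sphere_zero_iff_norm, LinearIsometryEquiv.norm_map]
    exact mem_sphere_zero_iff_norm.mp z.2⟩

/-- The identification of the unit circle of `ℝ²` with the unit circle of `ℂ`. -/
def sphereToCircle (u : SphereR2) : CircleC :=
  ⟨Complex.orthonormalBasisOneI.repr.symm u.1, by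
    rw [mem_sphere_zero_iff_norm, LinearIsometryEquiv.norm_map]
    exact mem_sphere_zero_iff_norm.mp u.2⟩

theorem circleToSphere_injective : Function.Injective circleToSphere := fun _ _ h =>
  Subtype.ext (Complex.orthonormalBasisOneI.repr.injective (congrArg Subtype.val h))

theorem sphereToCircle_injective : Function.Injective sphereToCircle := fun _ _ h =>
  Subtype.ext (Complex.orthonormalBasisOneI.repr.symm.injective (congrArg Subtype.val h))

theorem rdot_circleToSphere (z w : CircleC) :
    rdot (circleToSphere z) (circleToSphere w) = Cmap (cMul z w) := by
  apply Subtype.ext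
  simp only [rdot, circleToSphere, Cmap, cMul, LinearIsometryEquiv.inner_map_map, Complex.inner,
    Complex.mul_re, Complex.conj_re, Complex.conj_im]
  ring

theorem circleToSphere_sphereToCircle (u : SphereR2) :
    circleToSphere (sphereToCircle u) = u :=
  Subtype.ext (Complex.orthonormalBasisOneI.repr.apply_symm_apply u.1)

theorem Cmap_cMul_sphereToCircle (u v : SphereR2) :
    Cmap (cMul (sphereToCircle u) (sphereToCircle v)) = rdot u v := by
  rw [← rdot_circleToSphere, circleToSphere_sphereToCircle, circleToSphere_sphereToCircle]

theorem Cmap_circExp (φ : ℝ) : (Cmap (circExp φ)).1 = Real.cos φ :=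
  Complex.exp_ofReal_mul_I_re φ

theorem Cmap_Cminus (x : IccT) : Cmap (Cminus x) = x :=
  Subtype.ext <| (Cmap_circExp _).trans (Real.cos_arccos x.2.1 x.2.2)

theorem continuous_Cmap : Continuous Cmap :=
  (Complex.continuous_re.comp continuous_subtype_val).subtype_mk _

theorem continuous_Cminus : Continuous Cminus :=
  Continuous.subtype_mk (by fun_prop) _

theorem exists_abs_le_pi_circExp_eq (z : CircleC) :
    ∃ φ : ℝ, |φ| ≤ Real.pi ∧ circExp φ = z := by
  refine ⟨Complex.arg z.1, Complex.abs_arg_le_pi _, Subtype.ext ?_⟩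
  have h := Complex.norm_mul_exp_arg_mul_I z.1
  rwa [mem_sphere_zero_iff_norm.mp z.2, Complex.ofReal_one, one_mul] at h

/-- A conjugation-invariant function on the circle factors through the real part. -/
theorem apply_Cminus_Cmap {f : CircleC → ℂ}
    (hf : ∀ φ : ℝ, f (circExp φ) = f (circExp (-φ))) (z : CircleC) :
    f (Cminus (Cmap z)) = f z := by
  obtain ⟨φ, hπ, rfl⟩ := exists_abs_le_pi_circExp_eq z
  have h : Cminus (Cmap (circExp φ)) = circExp |φ| := by
    rw [Cminus, Cmap_circExp, ← Real.cos_abs, Real.arccos_cos (abs_nonneg φ) hπ]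
  rw [h]
  rcases abs_choice φ with h | h <;> rw [h]
  exact (hf φ).symm

theorem comp_Cminus_mem_classS1 {strict : Bool} {f : CircleC → ℂ}
    (hf : f ∈ classCircle strict) : f ∘ Cminus ∈ classS1 strict := by
  obtain ⟨hc, hpd, hconj⟩ := hf
  refine ⟨hc.comp continuous_Cminus, ?_⟩
  have h : (fun u v => (f ∘ Cminus) (rdot u v)) =
      fun u v => f (cMul (sphereToCircle u) (sphereToCircle v)) := by
    funext u v
    rw [← Cmap_cMul_sphereToCircle]
    exact apply_Cminus_Cmap hconj _
  rw [h]
  cases strict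
  · exact IsPDKernelT.comp_injective (K := fun z w => f (cMul z w)) hpd sphereToCircle_injective
  · exact IsSPDKernelT.comp_injective (K := fun z w => f (cMul z w)) hpd sphereToCircle_injective

theorem comp_Cmap_mem_classCircle {strict : Bool} {g : IccT → ℂ}
    (hg : g ∈ classS1 strict) : g ∘ Cmap ∈ classCircle strict := by
  obtain ⟨hc, hpd⟩ := hg
  refine ⟨hc.comp continuous_Cmap, ?_, fun φ => congrArg g (Subtype.ext ?_)⟩
  · simp only [Function.comp_apply, ← rdot_circleToSphere]
    cases strict
    · exact IsPDKernelT.comp_injective (K := fun u v => g (rdot u v)) hpd circleToSphere_injective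
    · exact IsSPDKernelT.comp_injective (K := fun u v => g (rdot u v)) hpd circleToSphere_injective
  · rw [Cmap_circExp, Cmap_circExp, Real.cos_neg]

/-- Lemma 6.1 / `lm_bij_1`: the map `B : f ↦ f ∘ C⁻` is a bijection
from the continuous PD (resp. SPD) functions on `Ω₂` invariant under conjugation onto
the continuous PD (resp. SPD) functions on `S¹`, with inverse `ĝ ↦ ĝ ∘ C`. -/
theorem stmt17 (strict : Bool) :
    Set.BijOn (fun (f : CircleC → ℂ) => f ∘ Cminus)
      (classCircle strict) (classS1 strict) ∧
    Set.InvOn (fun (g : IccT → ℂ) => g ∘ Cmap) (fun (f : CircleC → ℂ) => f ∘ Cminus)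
      (classCircle strict) (classS1 strict) := by
  have hinv : Set.InvOn (fun (g : IccT → ℂ) => g ∘ Cmap) (fun (f : CircleC → ℂ) => f ∘ Cminus)
      (classCircle strict) (classS1 strict) :=
    ⟨fun _ hf => funext (apply_Cminus_Cmap hf.2.2),
      fun g _ => funext fun x => congrArg g (Cmap_Cminus x)⟩
  exact ⟨hinv.bijOn (fun _ => comp_Cminus_mem_classS1) (fun _ => comp_Cmap_mem_classCircle), hinv⟩

end
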